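/- arXiv:1303.7256 — 4 statements merged into one kernel-verified Lean document; each statement's English description precedes it below -/
import Mathlib

section
/- For p = (p₁,p₂,p₃) ∈ ℤ³ write |p|² = p₁²+p₂²+p₃² and σ(p) = p₁+p₂+p₃. Then lim_{α→0⁺} α^{5/2} · ∑_{p∈ℤ³} σ(p)² · e^{-α(|p|² + σ(p)²)} = 3π^{3/2}/16. -/
open Filter

open MeasureTheory in
theorem aux_int (n : ℕ) : Integrable (fun x : ℝ => x ^ n * Real.exp (-x ^ 2)) := by
  have := integrable_rpow_mul_exp_neg_mul_sq (b := 1) one_pos (s := n)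
    (by have : (0:ℝ) ≤ n := n.cast_nonneg
        linarith)
  simpa using this

open MeasureTheory in
theorem aux_M0 : ∫ x : ℝ, x ^ 0 * Real.exp (-x ^ 2) = √Real.pi := by
  have := integral_gaussian 1
  simpa using this

open MeasureTheory in
theorem aux_M1 : ∫ x : ℝ, x ^ 1 * Real.exp (-x ^ 2) = 0 := by
  have h := integral_neg_eq_self (fun x : ℝ => x ^ 1 * Real.exp (-x ^ 2)) volume
  have h2 : (fun x : ℝ => (-x) ^ 1 * Real.exp (-(-x) ^ 2))
      = fun x : ℝ => -(x ^ 1 * Real.exp (-x ^ 2)) := by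
    funext x; simp
  rw [h2, integral_neg] at h
  linarith

open MeasureTheory in
theorem aux_M2 : ∫ x : ℝ, x ^ 2 * Real.exp (-x ^ 2) = √Real.pi / 2 := by
  have h := integral_comp_abs (f := fun x : ℝ => x ^ 2 * Real.exp (-x ^ 2))
  simp only [sq_abs] at h
  rw [h]
  have h2 := integral_rpow_mul_exp_neg_mul_rpow (p := 2) (q := 2) (b := 1)
    (by norm_num) (by norm_num) (by norm_num)
  simp only [Real.rpow_ofNat, neg_mul, one_mul, Real.one_rpow] at h2
  rw [h2]
  have h3 : Real.Gamma ((2 + 1) / 2) = √Real.pi / 2 := by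
    rw [show ((2:ℝ) + 1) / 2 = 1 / 2 + 1 by norm_num, Real.Gamma_add_one (by norm_num),
      Real.Gamma_one_half_eq]
    ring
  rw [h3]; ring

open MeasureTheory in
theorem aux_prod (a b c : ℕ) :
    Integrable (fun x : Fin 3 → ℝ =>
      x 0 ^ a * x 1 ^ b * x 2 ^ c * Real.exp (-(∑ i, x i ^ 2))) ∧
    ∫ x : Fin 3 → ℝ, x 0 ^ a * x 1 ^ b * x 2 ^ c * Real.exp (-(∑ i, x i ^ 2)) =
      (∫ x : ℝ, x ^ a * Real.exp (-x ^ 2)) * (∫ x : ℝ, x ^ b * Real.exp (-x ^ 2)) *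
      (∫ x : ℝ, x ^ c * Real.exp (-x ^ 2)) := by
  have e : (fun x : Fin 3 → ℝ => x 0 ^ a * x 1 ^ b * x 2 ^ c * Real.exp (-(∑ i, x i ^ 2)))
      = fun x : Fin 3 → ℝ => ∏ i, (fun y : ℝ => y ^ (![a, b, c] i) * Real.exp (-y ^ 2)) (x i) := by
    funext x
    simp only [Fin.sum_univ_three, Fin.prod_univ_three, neg_add, Real.exp_add]
    simp
    ring
  constructor
  · rw [e]
    exact Integrable.fintype_prod (f := fun i (y : ℝ) => y ^ (![a, b, c] i) * Real.exp (-y ^ 2))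
      (fun i => aux_int _)
  · rw [e, integral_fintype_prod_volume_eq_prod
      (fun i (y : ℝ) => y ^ (![a, b, c] i) * Real.exp (-y ^ 2))]
    simp [Fin.prod_univ_three]

open MeasureTheory in
theorem aux_diag : ∫ x : Fin 3 → ℝ, (∑ i, x i) ^ 2 * Real.exp (-(∑ i, x i ^ 2)) =
    3 * (√Real.pi) ^ 3 / 2 := by
  have e : (fun x : Fin 3 → ℝ => (∑ i, x i) ^ 2 * Real.exp (-(∑ i, x i ^ 2)))
    = fun x => ((((x 0 ^ 2 * x 1 ^ 0 * x 2 ^ 0 * Real.exp (-(∑ i, x i ^ 2)) +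
      x 0 ^ 0 * x 1 ^ 2 * x 2 ^ 0 * Real.exp (-(∑ i, x i ^ 2))) +
      x 0 ^ 0 * x 1 ^ 0 * x 2 ^ 2 * Real.exp (-(∑ i, x i ^ 2))) +
      2 * (x 0 ^ 1 * x 1 ^ 1 * x 2 ^ 0 * Real.exp (-(∑ i, x i ^ 2)))) +
      2 * (x 0 ^ 1 * x 1 ^ 0 * x 2 ^ 1 * Real.exp (-(∑ i, x i ^ 2)))) +
      2 * (x 0 ^ 0 * x 1 ^ 1 * x 2 ^ 1 * Real.exp (-(∑ i, x i ^ 2))) := by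
    funext x
    rw [Fin.sum_univ_three (fun i => x i)]
    ring
  have i1 := (aux_prod 2 0 0).1
  have i2 := (aux_prod 0 2 0).1
  have i3 := (aux_prod 0 0 2).1
  have i4 := (aux_prod 1 1 0).1.const_mul 2
  have i5 := (aux_prod 1 0 1).1.const_mul 2
  have i6 := (aux_prod 0 1 1).1.const_mul 2
  rw [e, integral_add ?_ i6, integral_add ?_ i5, integral_add ?_ i4, integral_add ?_ i3,
    integral_add i1 i2]
  · simp only [integral_const_mul]
    rw [(aux_prod 2 0 0).2, (aux_prod 0 2 0).2, (aux_prod 0 0 2).2, (aux_prod 1 1 0).2,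
      (aux_prod 1 0 1).2, (aux_prod 0 1 1).2, aux_M0, aux_M1, aux_M2]
    ring
  · exact i1.add i2
  · exact (i1.add i2).add i3
  · exact ((i1.add i2).add i3).add i4
  · exact (((i1.add i2).add i3).add i4).add i5

/-- the profile function -/
noncomputable def profile (x : Fin 3 → ℝ) : ℝ :=
  (∑ i, x i) ^ 2 * Real.exp (-((∑ i, x i ^ 2) + (∑ i, x i) ^ 2))

theorem profile_cont : Continuous profile := by
  unfold profile; fun_prop

open MeasureTheory in
theorem profile_integral : ∫ x, profile x = 3 * (√Real.pi) ^ 3 / 16 := by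
  let M : Matrix (Fin 3) (Fin 3) ℝ :=
    !![5/6, -1/6, -1/6; -1/6, 5/6, -1/6; -1/6, -1/6, 5/6]
  have hdet : M.det = 1 / 2 := by
    simp [M, Matrix.det_fin_three]; norm_num
  have hm := Real.map_matrix_volume_pi_eq_smul_volume_pi (M := M) (by rw [hdet]; norm_num)
  have hmeas : Measurable (Matrix.toLin' M) :=
    (LinearMap.continuous_of_finiteDimensional _).measurable
  have h1 := integral_map (μ := volume) hmeas.aemeasurable (f := profile)
    profile_cont.aestronglyMeasurable
  rw [hm, integral_smul_measure, hdet] at h1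
  have h2 : ∀ x : Fin 3 → ℝ, profile (Matrix.toLin' M x) =
      (1 / 4) * ((∑ i, x i) ^ 2 * Real.exp (-(∑ i, x i ^ 2))) := by
    intro x
    have a0 : Matrix.toLin' M x 0 = 5/6 * x 0 - 1/6 * x 1 - 1/6 * x 2 := by
      simp [M, Matrix.mulVec, dotProduct, Fin.sum_univ_three]; ring
    have a1 : Matrix.toLin' M x 1 = -1/6 * x 0 + 5/6 * x 1 - 1/6 * x 2 := by
      simp [M, Matrix.mulVec, dotProduct, Fin.sum_univ_three]; ring
    have a2 : Matrix.toLin' M x 2 = -1/6 * x 0 - 1/6 * x 1 + 5/6 * x 2 := by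
      simp [M, Matrix.mulVec, dotProduct, Fin.sum_univ_three]; ring
    unfold profile
    simp only [Fin.sum_univ_three, a0, a1, a2]
    rw [← mul_assoc]
    congr 1
    · ring
    · congr 1; ring
  simp only [h2] at h1
  rw [integral_const_mul, aux_diag] at h1
  norm_num at h1
  linarith

theorem profile_nonneg (x : Fin 3 → ℝ) : 0 ≤ profile x := by
  unfold profile; positivity

theorem profile_le (x : Fin 3 → ℝ) : profile x ≤ ∏ i, Real.exp (-x i ^ 2) := by
  unfold profile
  rw [← Real.exp_sum, neg_add, Real.exp_add, Finset.sum_neg_distrib]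
  set s := (∑ i, x i) ^ 2 with hs
  have h1 : s * Real.exp (-s) ≤ 1 := by
    rw [Real.exp_neg, ← div_eq_mul_inv, div_le_one (Real.exp_pos _)]
    linarith [Real.add_one_le_exp s]
  have := Real.exp_pos (-∑ i, x i ^ 2)
  nlinarith

/-- dominating function -/
noncomputable def domi (x : Fin 3 → ℝ) : ℝ :=
  ∏ i, (fun y : ℝ => Real.exp 1 * Real.exp (-(1/2) * y ^ 2)) (x i)

open MeasureTheory in
theorem domi_int : Integrable domi := by
  unfold domi
  exact Integrable.fintype_prod (f := fun _ (y : ℝ) => Real.exp 1 * Real.exp (-(1/2) * y ^ 2))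
    (fun i => (integrable_exp_neg_mul_sq (by norm_num)).const_mul _)

theorem floor_close {h : ℝ} (hh : 0 < h) (x : ℝ) : |h * ⌊h⁻¹ * x⌋ - x| ≤ h := by
  have h1 := Int.floor_le (h⁻¹ * x)
  have h2 := Int.lt_floor_add_one (h⁻¹ * x)
  have h3 : h * (h⁻¹ * x) = x := by field_simp
  rw [abs_le]
  constructor <;> nlinarith

theorem profile_dom {h : ℝ} (hh : 0 < h) (h1 : h ≤ 1) (x : Fin 3 → ℝ) :
    profile (fun i => h * ⌊h⁻¹ * x i⌋) ≤ domi x := by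
  refine (profile_le _).trans ?_
  unfold domi
  refine Finset.prod_le_prod (fun i _ => (Real.exp_pos _).le) (fun i _ => ?_)
  simp only [← Real.exp_add]
  apply Real.exp_le_exp.mpr
  have := abs_le.mp ((floor_close hh (x i)).trans h1)
  set y := h * (⌊h⁻¹ * x i⌋ : ℝ)
  nlinarith [sq_nonneg (2 * y - x i)]

/-- coordinatewise floor -/
noncomputable def vfloor (x : Fin 3 → ℝ) : Fin 3 → ℤ := fun i => ⌊x i⌋

theorem vfloor_meas : Measurable vfloor := by
  unfold vfloor
  exact measurable_pi_lambda _ (fun i => (measurable_pi_apply i).floor)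

open MeasureTheory in
theorem vfloor_map : Measure.map vfloor volume = Measure.count := by
  apply Measure.ext_of_singleton
  intro p
  rw [Measure.map_apply vfloor_meas (measurableSet_singleton p), Measure.count_singleton]
  have : vfloor ⁻¹' {p} = Set.univ.pi fun i => Set.Ico (p i : ℝ) (p i + 1) := by
    ext x
    simp [vfloor, funext_iff, Int.floor_eq_iff]
  rw [this, Real.volume_pi_Ico]
  simp

open MeasureTheory in
theorem sum_eq {h : ℝ} (hh : 0 < h) (h1 : h ≤ 1) :
    ∫ x : Fin 3 → ℝ, profile (fun i => h * ⌊h⁻¹ * x i⌋) =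
      h ^ 3 * ∑' p : Fin 3 → ℤ, profile (fun i => h * p i) := by
  let G : (Fin 3 → ℝ) → ℝ := fun y => profile (fun i => h * (vfloor y i : ℝ))
  have hGm : Measurable G := by
    have : Measurable (fun p : Fin 3 → ℤ => profile (fun i => h * (p i : ℝ))) :=
      measurable_of_countable _
    exact this.comp vfloor_meas
  have e := Measure.integral_comp_inv_smul (volume : Measure (Fin 3 → ℝ)) G h
  have hi : Integrable (fun x : Fin 3 → ℝ => G (h⁻¹ • x)) := by
    refine domi_int.mono' (hGm.comp (measurable_const_smul _)).aestronglyMeasurable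
      (Eventually.of_forall fun x => ?_)
    rw [Real.norm_of_nonneg (profile_nonneg _)]
    exact profile_dom hh h1 x
  have hG : Integrable G := by
    exact (integrable_comp_smul_iff volume G (inv_ne_zero hh.ne')).mp hi
  have hc : Integrable (fun p : Fin 3 → ℤ => profile (fun i => h * (p i : ℝ)))
      (Measure.map vfloor volume) :=
    (integrable_map_measure (measurable_of_countable _).aestronglyMeasurable
      vfloor_meas.aemeasurable).mpr hG
  have e2 := integral_map (μ := volume) vfloor_meas.aemeasurable hc.aestronglyMeasurable
  rw [integral_countable hc, vfloor_map] at e2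
  simp only [Measure.real, Measure.count_singleton, ENNReal.toReal_one, one_smul] at e2
  change ∫ x : Fin 3 → ℝ, G (h⁻¹ • x) = _
  rw [e, e2]
  simp [G, abs_of_pos hh]

theorem stmt_rewrite {α : ℝ} (ha : 0 < α) :
    α ^ ((5 : ℝ) / 2) * ∑' p : Fin 3 → ℤ,
        (∑ i, (p i : ℝ)) ^ 2 *
          Real.exp (-α * ((∑ i, (p i : ℝ) ^ 2) + (∑ i, (p i : ℝ)) ^ 2)) =
    (√α) ^ 3 * ∑' p : Fin 3 → ℤ, profile (fun i => √α * p i) := by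
  have hs : √α ^ 2 = α := Real.sq_sqrt ha.le
  have h5 : α ^ ((5 : ℝ) / 2) = √α ^ 3 * α := by
    rw [Real.sqrt_eq_rpow, ← Real.rpow_natCast, ← Real.rpow_mul ha.le]
    nth_rewrite 3 [← Real.rpow_one α]
    rw [← Real.rpow_add ha]
    norm_num
  rw [h5, mul_assoc, ← tsum_mul_left]
  congr 2
  funext p
  unfold profile
  simp only [← Finset.mul_sum, mul_pow, hs]
  rw [← mul_assoc]
  congr 2
  ring

/-- `lim_{α→0⁺} α^{5/2} · ∑_{p∈ℤ³} σ(p)² · e^{-α(|p|² + σ(p)²)} = 3π^{3/2}/16`. -/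
theorem stmt8 :
    Tendsto (fun α : ℝ =>
      α ^ ((5 : ℝ) / 2) * ∑' p : Fin 3 → ℤ,
        (∑ i, (p i : ℝ)) ^ 2 *
          Real.exp (-α * ((∑ i, (p i : ℝ) ^ 2) + (∑ i, (p i : ℝ)) ^ 2)))
      (nhdsWithin 0 (Set.Ioi 0)) (nhds (3 * Real.pi ^ ((3 : ℝ) / 2) / 16)) := by
  have hev : ∀ᶠ α : ℝ in nhdsWithin 0 (Set.Ioi 0), 0 < √α ∧ √α ≤ 1 ∧ 0 < α := by
    filter_upwards [Ioo_mem_nhdsGT (one_pos : (0:ℝ) < 1)] with α hα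
    exact ⟨Real.sqrt_pos.mpr hα.1, Real.sqrt_le_one.mpr hα.2.le, hα.1⟩
  have hpi : 3 * Real.pi ^ ((3 : ℝ) / 2) / 16 = ∫ x, profile x := by
    rw [profile_integral, Real.sqrt_eq_rpow, ← Real.rpow_natCast,
      ← Real.rpow_mul Real.pi_pos.le]
    norm_num
  rw [hpi]
  have key : Tendsto (fun α : ℝ => ∫ x : Fin 3 → ℝ,
      profile (fun i => √α * ⌊(√α)⁻¹ * x i⌋)) (nhdsWithin 0 (Set.Ioi 0))
      (nhds (∫ x, profile x)) := by
    refine MeasureTheory.tendsto_integral_filter_of_dominated_convergence domi ?_ ?_ domi_int ?_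
    · refine Eventually.of_forall fun α => ?_
      refine (profile_cont.measurable.comp ?_).aestronglyMeasurable
      exact measurable_pi_lambda _ (fun i => by fun_prop)
    · filter_upwards [hev] with α hα
      refine Eventually.of_forall fun x => ?_
      rw [Real.norm_of_nonneg (profile_nonneg _)]
      exact profile_dom hα.1 hα.2.1 x
    · refine Eventually.of_forall fun x => ?_
      refine (profile_cont.tendsto x).comp (tendsto_pi_nhds.mpr fun i => ?_)
      rw [tendsto_iff_dist_tendsto_zero]
      have h0 : Tendsto (fun α : ℝ => √α) (nhdsWithin 0 (Set.Ioi 0)) (nhds 0) := by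
        have := (Real.continuous_sqrt.tendsto 0).mono_left
          (nhdsWithin_le_nhds (s := Set.Ioi 0))
        simpa using this
      refine squeeze_zero' (Eventually.of_forall fun _ => dist_nonneg) ?_ h0
      filter_upwards [hev] with α hα
      rw [Real.dist_eq]
      exact floor_close hα.1 (x i)
  refine key.congr' ?_
  filter_upwards [hev] with α hα
  rw [stmt_rewrite hα.2.2, sum_eq hα.1 hα.2.1]
end

section
/- For p = (p₁,p₂,p₃,p₄) ∈ ℤ⁴ write |p|² = p₁²+p₂²+p₃²+p₄² and σ(p) = p₁+p₂+p₃+p₄. Then lim_{α→0⁺} α³ · ∑_{p∈ℤ⁴} σ(p)² · e^{-α(|p|² + (7/3)σ(p)²)} = 6√3·π²/(31√31). -/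
open Filter

/-- The function whose Riemann sums we consider. -/
noncomputable def gaussF (x : Fin 4 → ℝ) : ℝ :=
  (∑ i, x i) ^ 2 * Real.exp (-((∑ i, (x i) ^ 2) + (7 / 3) * (∑ i, x i) ^ 2))

lemma gaussF_continuous : Continuous gaussF := by
  unfold gaussF
  fun_prop

lemma gaussF_nonneg (x : Fin 4 → ℝ) : 0 ≤ gaussF x := by
  unfold gaussF
  positivity

lemma gaussF_le (x : Fin 4 → ℝ) : gaussF x ≤ ∏ i, Real.exp (-(x i) ^ 2) := by
  unfold gaussF
  rw [← Real.exp_sum, neg_add, Real.exp_add, Finset.sum_neg_distrib]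
  set s := ∑ i, x i
  have h1 : s ^ 2 * Real.exp (-(7 / 3 * s ^ 2)) ≤ 1 := by
    have h2 := Real.add_one_le_exp (7 / 3 * s ^ 2)
    rw [Real.exp_neg, ← div_eq_mul_inv, div_le_one (Real.exp_pos _)]
    nlinarith [sq_nonneg s]
  have h3 := Real.exp_pos (-∑ i, x i ^ 2)
  nlinarith

/-- rounding down to the lattice of mesh `h` -/
noncomputable def rnd (h : ℝ) (x : Fin 4 → ℝ) : Fin 4 → ℝ := fun i => h * (⌊x i / h⌋ : ℝ)

lemma rnd_close {h : ℝ} (hh : 0 < h) (x : Fin 4 → ℝ) (i : Fin 4) : |rnd h x i - x i| ≤ h := by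
  unfold rnd
  have h1 := Int.floor_le (x i / h)
  have h2 := Int.lt_floor_add_one (x i / h)
  rw [le_div_iff₀ hh] at h1
  rw [div_lt_iff₀ hh] at h2
  rw [abs_le]
  constructor <;> nlinarith

lemma rnd_measurable (h : ℝ) : Measurable (rnd h) := by
  unfold rnd
  refine measurable_pi_lambda _ fun i => ?_
  refine Measurable.const_mul ?_ _
  have : Measurable fun x : Fin 4 → ℝ => ⌊x i / h⌋ := by
    apply Measurable.floor
    fun_prop
  exact measurable_from_top.comp this

lemma bound_rnd {h : ℝ} (hh : 0 < h) (h1 : h ≤ 1) (x : Fin 4 → ℝ) :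
    ‖gaussF (rnd h x)‖ ≤ ∏ i, (Real.exp 1 * Real.exp (-(1 / 2) * (x i) ^ 2)) := by
  rw [Real.norm_of_nonneg (gaussF_nonneg _)]
  refine (gaussF_le _).trans ?_
  refine Finset.prod_le_prod (fun i _ => (Real.exp_pos _).le) fun i _ => ?_
  rw [← Real.exp_add]
  apply Real.exp_le_exp.2
  have h2 := abs_le.1 ((rnd_close hh x i).trans h1)
  set y := rnd h x i
  nlinarith [sq_nonneg (x i - 2 * (x i - y)), mul_nonneg (by linarith [h2.1] : 0 ≤ y - x i + 1)
    (by linarith [h2.2] : 0 ≤ 1 - (y - x i))]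

lemma bound_integrable : MeasureTheory.Integrable
    (fun x : Fin 4 → ℝ => ∏ i, (Real.exp 1 * Real.exp (-(1 / 2) * (x i) ^ 2))) := by
  apply MeasureTheory.Integrable.fintype_prod
    (f := fun (_ : Fin 4) (t : ℝ) => Real.exp 1 * Real.exp (-(1 / 2) * t ^ 2))
  intro i
  exact (integrable_exp_neg_mul_sq (by norm_num)).const_mul _

lemma rnd_integrable {h : ℝ} (hh : 0 < h) (h1 : h ≤ 1) :
    MeasureTheory.Integrable (fun x => gaussF (rnd h x)) := by
  refine bound_integrable.mono' ?_ (MeasureTheory.ae_of_all _ (bound_rnd hh h1))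
  exact (gaussF_continuous.measurable.comp (rnd_measurable h)).aestronglyMeasurable

lemma rnd_tendsto : Tendsto (fun h : ℝ => ∫ x, gaussF (rnd h x)) (nhdsWithin 0 (Set.Ioi 0))
    (nhds (∫ x, gaussF x)) := by
  have hev : ∀ᶠ h : ℝ in nhdsWithin 0 (Set.Ioi 0), 0 < h ∧ h ≤ 1 := by
    filter_upwards [Ioc_mem_nhdsGT (zero_lt_one (α := ℝ))] with h hh using hh
  refine MeasureTheory.tendsto_integral_filter_of_dominated_convergence _ ?_ ?_
    bound_integrable ?_
  · filter_upwards [hev] with h hh using (rnd_integrable hh.1 hh.2).aestronglyMeasurable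
  · filter_upwards [hev] with h hh using MeasureTheory.ae_of_all _ (bound_rnd hh.1 hh.2)
  · refine MeasureTheory.ae_of_all _ fun x => ?_
    refine (gaussF_continuous.tendsto x).comp ?_
    rw [tendsto_pi_nhds]
    intro i
    rw [tendsto_iff_dist_tendsto_zero]
    refine squeeze_zero' (g := fun h => h) (Eventually.of_forall fun _ => dist_nonneg) ?_
      (tendsto_id.mono_left nhdsWithin_le_nhds)
    filter_upwards [hev] with h hh using rnd_close hh.1 x i

lemma integral_rnd {h : ℝ} (hh : 0 < h) (h1 : h ≤ 1) :
    ∫ x, gaussF (rnd h x) = h ^ 4 * ∑' p : Fin 4 → ℤ, gaussF (fun i => h * (p i : ℝ)) := by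
  let s : (Fin 4 → ℤ) → Set (Fin 4 → ℝ) := fun p =>
    Set.pi Set.univ fun i => Set.Ico (h * (p i : ℝ)) (h * ((p i : ℝ) + 1))
  have hmem : ∀ p x, x ∈ s p ↔ (fun i => ⌊x i / h⌋) = p := by
    intro p x
    simp only [s, Set.mem_univ_pi, Set.mem_Ico, funext_iff, Int.floor_eq_iff, le_div_iff₀ hh,
      div_lt_iff₀ hh, mul_comm h]
  have hms : ∀ p, MeasurableSet (s p) := fun p =>
    MeasurableSet.univ_pi fun i => measurableSet_Ico
  have hdisj : Pairwise (Function.onFun Disjoint s) := by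
    intro p q hpq
    refine Set.disjoint_left.2 fun x hx hx' => hpq ?_
    rw [← (hmem p x).1 hx, ← (hmem q x).1 hx']
  have hun : ⋃ p, s p = Set.univ := by
    refine Set.eq_univ_of_forall fun x => Set.mem_iUnion.2 ⟨_, (hmem _ x).2 rfl⟩
  have key := MeasureTheory.integral_iUnion (μ := MeasureTheory.volume) hms hdisj
    (f := fun x => gaussF (rnd h x)) (rnd_integrable hh h1).integrableOn
  rw [hun, MeasureTheory.setIntegral_univ] at key
  rw [key, ← tsum_mul_left]
  refine tsum_congr fun p => ?_
  have : ∫ x in s p, gaussF (rnd h x) = ∫ x in s p, gaussF (fun i => h * (p i : ℝ)) := by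
    refine MeasureTheory.setIntegral_congr_fun (hms p) fun x hx => ?_
    have := (hmem p x).1 hx
    simp only [← this]
    rfl
  rw [this, MeasureTheory.setIntegral_const, smul_eq_mul]
  congr 1
  rw [MeasureTheory.measureReal_def, Real.volume_pi_Ico_toReal]
  · simp [mul_add]
  · intro i
    simp only
    nlinarith

lemma integral_sq_gauss {b : ℝ} (hb : 0 < b) :
    ∫ t : ℝ, t ^ 2 * Real.exp (-b * t ^ 2) = Real.sqrt Real.pi / (2 * (b * Real.sqrt b)) := by
  have h1 := integral_comp_abs (f := fun t : ℝ => t ^ 2 * Real.exp (-b * t ^ 2))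
  simp only [sq_abs] at h1
  have h2 := integral_rpow_mul_exp_neg_mul_rpow (p := 2) (q := 2) (b := b) (by norm_num)
    (by norm_num) hb
  simp only [Real.rpow_two] at h2
  rw [h1, h2]
  have h3 : Real.Gamma ((2 + 1) / 2) = Real.sqrt Real.pi / 2 := by
    rw [show ((2 : ℝ) + 1) / 2 = 1 / 2 + 1 by norm_num, Real.Gamma_add_one (by norm_num),
      Real.Gamma_one_half_eq]
    ring
  have h4 : b ^ (-((2 : ℝ) + 1) / 2) = (b * Real.sqrt b)⁻¹ := by
    rw [show (-((2 : ℝ) + 1) / 2) = -(1 + 1 / 2) by norm_num, Real.rpow_neg hb.le,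
      Real.rpow_add hb, Real.rpow_one, Real.sqrt_eq_rpow]
  rw [h3, h4]
  have := Real.sqrt_pos.2 hb
  field_simp

/-- orthogonal matrix whose first row is `(1/2, 1/2, 1/2, 1/2)` -/
noncomputable def hadM : Matrix (Fin 4) (Fin 4) ℝ :=
  !![1/2, 1/2, 1/2, 1/2; 1/2, -1/2, 1/2, -1/2; 1/2, 1/2, -1/2, -1/2; 1/2, -1/2, -1/2, 1/2]

lemma hadM_det : |hadM.det| = 1 := by
  have h : hadM * hadM = 1 := by
    ext i j
    fin_cases i <;> fin_cases j <;>
      simp [hadM, Matrix.mul_apply, Fin.sum_univ_four] <;> norm_num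
  have h2 := congrArg Matrix.det h
  rw [Matrix.det_mul, Matrix.det_one] at h2
  rcases mul_self_eq_one_iff.1 h2 with h | h <;> simp [h]

lemma integral_gaussF :
    ∫ x, gaussF x = 6 * Real.sqrt 3 * Real.pi ^ 2 / (31 * Real.sqrt 31) := by
  let f : Fin 4 → ℝ → ℝ :=
    ![fun t => 4 * (t ^ 2 * Real.exp (-(31 / 3) * t ^ 2)), fun t => Real.exp (-1 * t ^ 2),
      fun t => Real.exp (-1 * t ^ 2), fun t => Real.exp (-1 * t ^ 2)]
  have hdet : hadM.det ≠ 0 := by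
    intro h
    have := hadM_det
    simp [h] at this
  have hmap := Real.map_matrix_volume_pi_eq_smul_volume_pi hdet
  rw [abs_inv, hadM_det, inv_one, ENNReal.ofReal_one, one_smul] at hmap
  have hfm : Continuous (fun y : Fin 4 → ℝ => ∏ i, f i (y i)) := by
    simp only [Fin.prod_univ_four, f]
    simp
    fun_prop
  have e1 : ∀ x, gaussF x = ∏ i, f i (Matrix.toLin' hadM x i) := by
    intro x
    simp only [Fin.prod_univ_four, f, gaussF, Matrix.toLin'_apply, Matrix.mulVec, dotProduct,
      Fin.sum_univ_four, hadM]
    simp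
    simp only [mul_assoc, ← Real.exp_add]
    rw [← mul_assoc]
    congr 1
    · ring
    · congr 1
      ring
  have e2 : ∫ x, gaussF x = ∫ y : Fin 4 → ℝ, ∏ i, f i (y i) := by
    simp_rw [e1]
    conv_rhs => rw [← hmap]
    rw [MeasureTheory.integral_map]
    · exact (LinearMap.continuous_of_finiteDimensional _).measurable.aemeasurable
    · exact hfm.aestronglyMeasurable
  rw [e2, MeasureTheory.integral_fintype_prod_volume_eq_prod]
  simp only [Fin.prod_univ_four, f]
  simp only [Matrix.cons_val_zero, Matrix.cons_val_one, Matrix.cons_val]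
  rw [MeasureTheory.integral_const_mul, integral_sq_gauss (by norm_num), integral_gaussian,
    div_one, Real.sqrt_div (by norm_num)]
  have hp : Real.sqrt Real.pi ^ 2 = Real.pi := Real.sq_sqrt Real.pi_pos.le
  have h3 : 0 < Real.sqrt 3 := by positivity
  have h31 : 0 < Real.sqrt 31 := by positivity
  rw [← hp]
  simp only [Real.sqrt_sq (Real.sqrt_nonneg Real.pi)]
  field_simp
  ring

/-- `lim_{α→0⁺} α³ · ∑_{p∈ℤ⁴} σ(p)² · e^{-α(|p|² + (7/3)σ(p)²)} = 6√3·π²/(31√31)`. -/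
theorem stmt9 :
    Tendsto (fun α : ℝ =>
      α ^ 3 * ∑' p : Fin 4 → ℤ,
        (∑ i, (p i : ℝ)) ^ 2 *
          Real.exp (-α * ((∑ i, (p i : ℝ) ^ 2) + (7 / 3) * (∑ i, (p i : ℝ)) ^ 2)))
      (nhdsWithin 0 (Set.Ioi 0))
      (nhds (6 * Real.sqrt 3 * Real.pi ^ 2 / (31 * Real.sqrt 31))) := by
  rw [← integral_gaussF]
  have hs : Tendsto Real.sqrt (nhdsWithin 0 (Set.Ioi 0)) (nhdsWithin 0 (Set.Ioi 0)) := by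
    refine tendsto_nhdsWithin_iff.2 ⟨?_, ?_⟩
    · have := Real.continuous_sqrt.tendsto 0
      rw [Real.sqrt_zero] at this
      exact this.mono_left nhdsWithin_le_nhds
    · filter_upwards [self_mem_nhdsWithin] with a ha using Real.sqrt_pos.2 ha
  refine (rnd_tendsto.comp hs).congr' ?_
  filter_upwards [Ioc_mem_nhdsGT (zero_lt_one (α := ℝ))] with a ha
  have h0 : 0 < Real.sqrt a := Real.sqrt_pos.2 ha.1
  have hsq : Real.sqrt a ^ 2 = a := Real.sq_sqrt ha.1.le
  rw [Function.comp_apply, integral_rnd h0 (Real.sqrt_le_one.2 ha.2), ← tsum_mul_left,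
    ← tsum_mul_left]
  refine tsum_congr fun p => ?_
  simp only [gaussF, ← Finset.mul_sum, mul_pow, hsq]
  rw [show Real.sqrt a ^ 4 = (Real.sqrt a ^ 2) ^ 2 by ring, hsq, ← mul_assoc, ← mul_assoc (a ^ 3)]
  congr 1
  · ring
  · congr 1
    ring
end

section
/- For p = (p₁,p₂,p₃,p₄) ∈ ℤ⁴ and q = (q₁,q₂) ∈ ℤ² write |p|² = ∑_k p_k², σ(p) = ∑_k p_k, |q|² = q₁²+q₂², σ(q) = q₁+q₂, and let Q(p,q) = |p|² + 3σ(p)² + |q|² + σ(q)² − 2σ(p)σ(q). Then lim_{α→0⁺} α⁴ · ∑_{(p,q)∈ℤ⁴×ℤ²} (|q|² + σ(p)²) · e^{-α·Q(p,q)} = 28π³/(31√31). -/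
open MeasureTheory Filter Topology

lemma map_floor_volume (n : ℕ) :
    Measure.map (fun (x : Fin n → ℝ) (i : Fin n) => ⌊x i⌋) volume = Measure.count := by
  have hm : Measurable (fun (x : Fin n → ℝ) (i : Fin n) => ⌊x i⌋) := by
    refine measurable_pi_lambda _ fun i => Int.measurable_floor.comp (measurable_pi_apply i)
  refine Measure.ext_of_singleton fun k => ?_
  rw [Measure.map_apply hm (measurableSet_singleton _), Measure.count_singleton]
  have : (fun (x : Fin n → ℝ) (i : Fin n) => ⌊x i⌋) ⁻¹' {k}
      = Set.pi Set.univ (fun i => Set.Ico (k i : ℝ) (k i + 1)) := by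
    ext x
    simp [funext_iff, Int.floor_eq_iff]
  rw [this, volume_pi_pi]
  simp

lemma floor_sq_bound {h : ℝ} (h0 : 0 < h) (h1 : h ≤ 1) (x : ℝ) :
    x ^ 2 / 2 - 1 ≤ (h * (⌊h⁻¹ * x⌋ : ℤ)) ^ 2 := by
  have a := Int.floor_le (h⁻¹ * x)
  have b := Int.lt_floor_add_one (h⁻¹ * x)
  have a' : h * (⌊h⁻¹ * x⌋ : ℤ) ≤ x := by
    calc _ ≤ h * (h⁻¹ * x) := by gcongr
      _ = x := by field_simp
  have b' : x ≤ h * (⌊h⁻¹ * x⌋ : ℤ) + h := by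
    calc x = h * (h⁻¹ * x) := by field_simp
      _ ≤ h * ((⌊h⁻¹ * x⌋ : ℤ) + 1) := by gcongr
      _ = _ := by ring
  set y := h * ((⌊h⁻¹ * x⌋ : ℤ) : ℝ)
  nlinarith [sq_nonneg (2 * y - x), mul_nonneg (sub_nonneg.2 a') (sub_nonneg.2 (b'.trans (add_le_add_right h1 y)))]

lemma floor_tendsto (x : ℝ) :
    Tendsto (fun h : ℝ => h * (⌊h⁻¹ * x⌋ : ℤ)) (𝓝[>] 0) (𝓝 x) := by
  have h1 : Tendsto (fun h : ℝ => x - h) (𝓝[>] 0) (𝓝 x) := by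
    have : Tendsto (fun h : ℝ => x - h) (𝓝 0) (𝓝 (x - 0)) := by
      exact Continuous.tendsto (by fun_prop) 0
    rw [sub_zero] at this
    exact this.mono_left nhdsWithin_le_nhds
  refine tendsto_of_tendsto_of_tendsto_of_le_of_le' h1 tendsto_const_nhds ?_ ?_
  · filter_upwards [self_mem_nhdsWithin] with h (hh : 0 < h)
    have b := (Int.lt_floor_add_one (h⁻¹ * x)).le
    have : x ≤ h * (⌊h⁻¹ * x⌋ : ℤ) + h := by
      calc x = h * (h⁻¹ * x) := by field_simp
        _ ≤ h * ((⌊h⁻¹ * x⌋ : ℤ) + 1) := by gcongr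
        _ = _ := by ring
    linarith
  · filter_upwards [self_mem_nhdsWithin] with h (hh : 0 < h)
    calc _ ≤ h * (h⁻¹ * x) := by gcongr; exact Int.floor_le _
      _ = x := by field_simp

lemma integrable_gauss_pi (n : ℕ) {c : ℝ} (hc : 0 < c) :
    Integrable (fun x : Fin n → ℝ => Real.exp (-c * ∑ i, x i ^ 2)) := by
  have := Integrable.fintype_prod (ι := Fin n) (f := fun _ (x : ℝ) => Real.exp (-c * x ^ 2))
    (μ := fun _ => volume) (fun _ => integrable_exp_neg_mul_sq hc)
  refine this.congr (Eventually.of_forall fun x => ?_)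
  simp only [Finset.mul_sum, Real.exp_sum]

lemma riemann_sum (n : ℕ) (f : (Fin n → ℝ) → ℝ) (hf : Continuous f) {C c : ℝ} (hc : 0 < c)
    (hC : 0 ≤ C) (hb : ∀ x, |f x| ≤ C * Real.exp (-c * ∑ i, x i ^ 2)) :
    Tendsto (fun h : ℝ => h ^ n * ∑' k : Fin n → ℤ, f (fun i => h * (k i : ℝ))) (𝓝[>] 0)
      (𝓝 (∫ x, f x)) := by
  have hm : Measurable (fun (x : Fin n → ℝ) (i : Fin n) => ⌊x i⌋) := by
    refine measurable_pi_lambda _ fun i => Int.measurable_floor.comp (measurable_pi_apply i)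
  set F : ℝ → (Fin n → ℝ) → ℝ := fun h x => f (fun i => h * ((⌊h⁻¹ * x i⌋ : ℤ) : ℝ)) with hF
  set B : (Fin n → ℝ) → ℝ := fun x =>
    C * Real.exp (c * n) * Real.exp (-(c / 2) * ∑ i, x i ^ 2) with hB
  have hBi : Integrable B := (integrable_gauss_pi n (half_pos hc)).const_mul _
  have hFm : ∀ h, Measurable (F h) := by
    intro h
    refine hf.measurable.comp (measurable_pi_lambda _ fun i => ?_)
    refine Measurable.const_mul ?_ _
    exact (measurable_from_top (f := fun z : ℤ => (z : ℝ))).comp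
      (Int.measurable_floor.comp ((measurable_pi_apply i).const_mul _))
  have hdom : ∀ h, 0 < h → h ≤ 1 → ∀ x, ‖F h x‖ ≤ B x := by
    intro h h0 h1 x
    refine (hb _).trans ?_
    simp only [hB]
    rw [mul_assoc, ← Real.exp_add]
    gcongr
    have : ∑ i, (x i ^ 2 / 2 - 1) ≤ ∑ i, (h * ((⌊h⁻¹ * x i⌋ : ℤ) : ℝ)) ^ 2 :=
      Finset.sum_le_sum fun i _ => floor_sq_bound h0 h1 (x i)
    rw [Finset.sum_sub_distrib, ← Finset.sum_div] at this
    simp at this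
    nlinarith
  have hlim : Tendsto (fun h => ∫ x, F h x) (𝓝[>] 0) (𝓝 (∫ x, f x)) := by
    refine tendsto_integral_filter_of_dominated_convergence B ?_ ?_ hBi ?_
    · exact Eventually.of_forall fun h => (hFm h).aestronglyMeasurable
    · filter_upwards [Ioc_mem_nhdsGT (zero_lt_one' ℝ)] with h hh
      exact Eventually.of_forall (hdom h hh.1 hh.2)
    · refine Eventually.of_forall fun x => ?_
      refine (hf.tendsto x).comp (tendsto_pi_nhds.2 fun i => floor_tendsto (x i))
  refine hlim.congr' ?_
  filter_upwards [Ioc_mem_nhdsGT (zero_lt_one' ℝ)] with h hh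
  have hFi : Integrable (F h) :=
    hBi.mono' (hFm h).aestronglyMeasurable (Eventually.of_forall (hdom h hh.1 hh.2))
  set g : (Fin n → ℤ) → ℝ := fun k => f (fun i => h * (k i : ℝ)) with hg
  set fl := (fun (x : Fin n → ℝ) (i : Fin n) => ⌊x i⌋) with hfl
  have e1 : F h = fun x => (g ∘ fl) (h⁻¹ • x) := by
    ext x; simp [hF, hg, hfl]
  have hgm : AEStronglyMeasurable g (Measure.map fl volume) :=
    (measurable_of_countable g).aestronglyMeasurable
  have hgi : Integrable (g ∘ fl) := by
    rw [e1] at hFi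
    exact (integrable_comp_smul_iff volume (g ∘ fl) (inv_ne_zero hh.1.ne')).1 hFi
  have hgc : Integrable g Measure.count := by
    rw [← map_floor_volume n]
    exact (integrable_map_measure hgm hm.aemeasurable).2 hgi
  rw [e1, Measure.integral_comp_inv_smul]
  have e2 : ∫ x, (g ∘ fl) x = ∑' k, g k := by
    have := integral_map (μ := volume) hm.aemeasurable hgm
    simp only [Function.comp]
    rw [← this, map_floor_volume, integral_countable hgc]
    simp [Measure.real]
  rw [e2]
  simp [abs_of_pos hh.1]

/-- One-dimensional Gaussian moments. -/
noncomputable def gm (k : ℕ) (b : ℝ) : ℝ := ∫ x : ℝ, x ^ k * Real.exp (-b * x ^ 2)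

lemma gm_integrable (k : ℕ) {b : ℝ} (hb : 0 < b) :
    Integrable (fun x : ℝ => x ^ k * Real.exp (-b * x ^ 2)) := by
  have := integrable_rpow_mul_exp_neg_mul_sq hb (s := k) (by
    have : (0 : ℝ) ≤ k := Nat.cast_nonneg k
    linarith)
  simpa [Real.rpow_natCast] using this

lemma gm_zero (b : ℝ) : gm 0 b = √(Real.pi / b) := by
  simp only [gm, pow_zero, one_mul]
  exact integral_gaussian b

lemma gm_one (b : ℝ) : gm 1 b = 0 := by
  have h := integral_neg_eq_self (fun x : ℝ => x ^ 1 * Real.exp (-b * x ^ 2)) volume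
  have h2 : ∫ x : ℝ, (-x) ^ 1 * Real.exp (-b * (-x) ^ 2) = - gm 1 b := by
    rw [gm, ← integral_neg]
    congr 1
    ext x
    rw [neg_sq]; ring
  have h3 : ∫ x : ℝ, (-x) ^ 1 * Real.exp (-b * (-x) ^ 2) = gm 1 b := h
  linarith

lemma gm_two {b : ℝ} (hb : 0 < b) : gm 2 b = √(Real.pi / b) / (2 * b) := by
  have h1 : gm 2 b = 2 * ∫ x in Set.Ioi (0 : ℝ), x ^ 2 * Real.exp (-b * x ^ 2) := by
    rw [gm, ← integral_comp_abs (f := fun x : ℝ => x ^ 2 * Real.exp (-b * x ^ 2))]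
    simp
  have h2 := integral_rpow_mul_exp_neg_mul_rpow (p := 2) (q := 2) (b := b) two_pos
    (by norm_num) hb
  simp only [Real.rpow_ofNat] at h2
  rw [h1, h2]
  have h3 : Real.Gamma ((2 + 1) / 2) = √Real.pi / 2 := by
    rw [show ((2 : ℝ) + 1) / 2 = 1 / 2 + 1 by norm_num, Real.Gamma_add_one (by norm_num),
      Real.Gamma_one_half_eq]
    ring
  have h4 : b ^ (-((2 : ℝ) + 1) / 2) = 1 / (b * √b) := by
    rw [show -((2 : ℝ) + 1) / 2 = -(1 + 1 / 2) by norm_num, Real.rpow_neg hb.le,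
      Real.rpow_add hb, Real.rpow_one, ← Real.sqrt_eq_rpow, one_div]
  rw [h3, h4, Real.sqrt_div Real.pi_pos.le]
  have := Real.sqrt_pos.2 hb
  field_simp

lemma gm_pi (d : Fin 6 → ℝ) (e : Fin 6 → ℕ) :
    ∫ y : Fin 6 → ℝ, (∏ i, y i ^ e i) * Real.exp (-∑ i, d i * y i ^ 2) = ∏ i, gm (e i) (d i) := by
  simp only [gm]
  rw [← integral_fintype_prod_volume_eq_prod]
  congr 1
  ext y
  rw [Finset.prod_mul_distrib, ← Real.exp_sum, ← Finset.sum_neg_distrib]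
  simp

lemma gm_pi_integrable (d : Fin 6 → ℝ) (hd : ∀ i, 0 < d i) (e : Fin 6 → ℕ) :
    Integrable fun y : Fin 6 → ℝ => (∏ i, y i ^ e i) * Real.exp (-∑ i, d i * y i ^ 2) := by
  have := Integrable.fintype_prod (ι := Fin 6)
    (f := fun i (x : ℝ) => x ^ e i * Real.exp (-(d i) * x ^ 2))
    (μ := fun _ => volume) (fun i => gm_integrable (e i) (hd i))
  refine this.congr (Eventually.of_forall fun y => ?_)
  simp only
  rw [Finset.prod_mul_distrib, ← Real.exp_sum, ← Finset.sum_neg_distrib]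
  simp

/-- Diagonal coefficients after completing squares. -/
noncomputable def dd : Fin 6 → ℝ := ![1 / 2, 1 / 6, 1 / 12, 31 / 12, 3 / 2, 1 / 2]

/-- The diagonalising change of variables. -/
noncomputable def MM : Matrix (Fin 6) (Fin 6) ℝ :=
  !![1, -1, 0, 0, 0, 0; 1, 1, -2, 0, 0, 0; 1, 1, 1, -3, 0, 0; 1, 1, 1, 1, 0, 0;
    -2 / 3, -2 / 3, -2 / 3, -2 / 3, 1, 1; 0, 0, 0, 0, 1, -1]

lemma MM_det : MM.det = -48 := by
  simp [MM, Matrix.det_succ_row_zero, Fin.sum_univ_succ, Fin.succAbove]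
  norm_num

lemma dd_pos : ∀ i, 0 < dd i := by
  intro i
  fin_cases i <;> norm_num [dd]

/-- The integrand in diagonal coordinates. -/
noncomputable def GG (y : Fin 6 → ℝ) : ℝ :=
  (11 / 9 * y 3 ^ 2 + 1 / 2 * y 4 ^ 2 + 2 / 3 * (y 3 * y 4) + 1 / 2 * y 5 ^ 2) *
    Real.exp (-∑ i, dd i * y i ^ 2)

/-- The integrand in the original coordinates. -/
noncomputable def ff (x : Fin 6 → ℝ) : ℝ :=
  (x 4 ^ 2 + x 5 ^ 2 + (x 0 + x 1 + x 2 + x 3) ^ 2) *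
    Real.exp (-((x 0 ^ 2 + x 1 ^ 2 + x 2 ^ 2 + x 3 ^ 2) + 3 * (x 0 + x 1 + x 2 + x 3) ^ 2
      + (x 4 ^ 2 + x 5 ^ 2) + (x 4 + x 5) ^ 2
      - 2 * (x 0 + x 1 + x 2 + x 3) * (x 4 + x 5)))

lemma GG_integral : ∫ y, GG y = 48 * (28 * Real.pi ^ 3 / (31 * Real.sqrt 31)) := by
  have i1 := gm_pi_integrable dd dd_pos ![0, 0, 0, 2, 0, 0]
  have i2 := gm_pi_integrable dd dd_pos ![0, 0, 0, 0, 2, 0]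
  have i3 := gm_pi_integrable dd dd_pos ![0, 0, 0, 1, 1, 0]
  have i4 := gm_pi_integrable dd dd_pos ![0, 0, 0, 0, 0, 2]
  have j1 := gm_pi dd ![0, 0, 0, 2, 0, 0]
  have j2 := gm_pi dd ![0, 0, 0, 0, 2, 0]
  have j3 := gm_pi dd ![0, 0, 0, 1, 1, 0]
  have j4 := gm_pi dd ![0, 0, 0, 0, 0, 2]
  have e : ∀ y, GG y =
      11 / 9 * ((∏ i, y i ^ (![0, 0, 0, 2, 0, 0] : Fin 6 → ℕ) i) * Real.exp (-∑ i, dd i * y i ^ 2))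
      + 1 / 2 * ((∏ i, y i ^ (![0, 0, 0, 0, 2, 0] : Fin 6 → ℕ) i) * Real.exp (-∑ i, dd i * y i ^ 2))
      + 2 / 3 * ((∏ i, y i ^ (![0, 0, 0, 1, 1, 0] : Fin 6 → ℕ) i) * Real.exp (-∑ i, dd i * y i ^ 2))
      + 1 / 2 * ((∏ i, y i ^ (![0, 0, 0, 0, 0, 2] : Fin 6 → ℕ) i) * Real.exp (-∑ i, dd i * y i ^ 2))
      := by
    intro y
    have p1 : (∏ i, y i ^ (![0, 0, 0, 2, 0, 0] : Fin 6 → ℕ) i) = y 3 ^ 2 := by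
      simp [Fin.prod_univ_six]
    have p2 : (∏ i, y i ^ (![0, 0, 0, 0, 2, 0] : Fin 6 → ℕ) i) = y 4 ^ 2 := by
      simp [Fin.prod_univ_six]
    have p3 : (∏ i, y i ^ (![0, 0, 0, 1, 1, 0] : Fin 6 → ℕ) i) = y 3 * y 4 := by
      simp [Fin.prod_univ_six]
    have p4 : (∏ i, y i ^ (![0, 0, 0, 0, 0, 2] : Fin 6 → ℕ) i) = y 5 ^ 2 := by
      simp [Fin.prod_univ_six]
    rw [p1, p2, p3, p4, GG]
    ring
  simp_rw [e]
  rw [integral_add, integral_add, integral_add, integral_const_mul, integral_const_mul,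
    integral_const_mul, integral_const_mul, j1, j2, j3, j4]
  rotate_left
  · exact i1.const_mul _
  · exact i2.const_mul _
  · exact (i1.const_mul _).add (i2.const_mul _)
  · exact i3.const_mul _
  · exact ((i1.const_mul _).add (i2.const_mul _)).add (i3.const_mul _)
  · exact i4.const_mul _
  have hprod : √(Real.pi / (1 / 2)) * √(Real.pi / (1 / 6)) * √(Real.pi / (1 / 12)) *
      √(Real.pi / (31 / 12)) * √(Real.pi / (3 / 2)) * √(Real.pi / (1 / 2))
      = 48 * Real.pi ^ 3 / √31 := by
    have hp := Real.pi_pos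
    rw [← Real.sqrt_mul (by positivity), ← Real.sqrt_mul (by positivity),
      ← Real.sqrt_mul (by positivity), ← Real.sqrt_mul (by positivity),
      ← Real.sqrt_mul (by positivity)]
    rw [Real.sqrt_eq_iff_mul_self_eq (by positivity) (by positivity)]
    have h31 : 48 * Real.pi ^ 3 / √31 * (48 * Real.pi ^ 3 / √31) = (48 * Real.pi ^ 3) ^ 2 / 31 := by
      rw [div_mul_div_comm, Real.mul_self_sqrt (by norm_num), sq]
    rw [h31]
    field_simp
    norm_num
  have hs : 0 < √(31 : ℝ) := by positivity
  have k1 : ∏ i, gm ((![0, 0, 0, 2, 0, 0] : Fin 6 → ℕ) i) (dd i)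
      = 48 * Real.pi ^ 3 / √31 * (6 / 31) := by
    rw [← hprod]
    simp only [Fin.prod_univ_six]
    simp [dd, gm_zero, gm_two]
    ring
  have k2 : ∏ i, gm ((![0, 0, 0, 0, 2, 0] : Fin 6 → ℕ) i) (dd i)
      = 48 * Real.pi ^ 3 / √31 * (1 / 3) := by
    rw [← hprod]
    simp only [Fin.prod_univ_six]
    simp [dd, gm_zero, gm_two]
    ring
  have k3 : ∏ i, gm ((![0, 0, 0, 1, 1, 0] : Fin 6 → ℕ) i) (dd i) = 0 := by
    simp only [Fin.prod_univ_six]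
    simp [gm_one]
  have k4 : ∏ i, gm ((![0, 0, 0, 0, 0, 2] : Fin 6 → ℕ) i) (dd i)
      = 48 * Real.pi ^ 3 / √31 * 1 := by
    rw [← hprod]
    simp only [Fin.prod_univ_six]
    simp [dd, gm_zero, gm_two]
  rw [k1, k2, k3, k4]
  field_simp
  ring

lemma ff_eq (x : Fin 6 → ℝ) : ff x = GG (Matrix.toLin' MM x) := by
  have v3 : Matrix.toLin' MM x 3 = x 0 + x 1 + x 2 + x 3 := by
    simp [MM, Matrix.mulVec, dotProduct, Fin.sum_univ_six]
  have v0 : Matrix.toLin' MM x 0 = x 0 - x 1 := by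
    simp [MM, Matrix.mulVec, dotProduct, Fin.sum_univ_six]; ring
  have v1 : Matrix.toLin' MM x 1 = x 0 + x 1 - 2 * x 2 := by
    simp [MM, Matrix.mulVec, dotProduct, Fin.sum_univ_six]; ring
  have v2 : Matrix.toLin' MM x 2 = x 0 + x 1 + x 2 - 3 * x 3 := by
    simp [MM, Matrix.mulVec, dotProduct, Fin.sum_univ_six]; ring
  have v4 : Matrix.toLin' MM x 4 = x 4 + x 5 - 2 / 3 * (x 0 + x 1 + x 2 + x 3) := by
    simp [MM, Matrix.mulVec, dotProduct, Fin.sum_univ_six]; ring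
  have v5 : Matrix.toLin' MM x 5 = x 4 - x 5 := by
    simp [MM, Matrix.mulVec, dotProduct, Fin.sum_univ_six]; ring
  have d0 : dd 0 = 1 / 2 := rfl
  have d1 : dd 1 = 1 / 6 := rfl
  have d2 : dd 2 = 1 / 12 := rfl
  have d3 : dd 3 = 31 / 12 := rfl
  have d4 : dd 4 = 3 / 2 := rfl
  have d5 : dd 5 = 1 / 2 := rfl
  rw [GG, Fin.sum_univ_six, v0, v1, v2, v3, v4, v5, d0, d1, d2, d3, d4, d5, ff]
  congr 1
  · ring
  · congr 1; ring

lemma ff_integral : ∫ x, ff x = 28 * Real.pi ^ 3 / (31 * Real.sqrt 31) := by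
  have hdet : MM.det ≠ 0 := by rw [MM_det]; norm_num
  have hmap := Real.map_matrix_volume_pi_eq_smul_volume_pi hdet
  have hGc : Continuous GG := by unfold GG; fun_prop
  have hLc : Continuous (Matrix.toLin' MM) := LinearMap.continuous_of_finiteDimensional _
  have := integral_map (μ := volume) (φ := Matrix.toLin' MM) (f := GG) hLc.measurable.aemeasurable
    hGc.aestronglyMeasurable
  simp_rw [ff_eq]
  rw [← this, hmap, integral_smul_measure, GG_integral, MM_det, ENNReal.toReal_ofReal (abs_nonneg _)]
  rw [abs_of_neg (by norm_num), smul_eq_mul]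
  ring

lemma ff_bound (x : Fin 6 → ℝ) : |ff x| ≤ 8 * Real.exp (-(1 / 2) * ∑ i, x i ^ 2) := by
  rw [Fin.sum_univ_six]
  set r := x 0 ^ 2 + x 1 ^ 2 + x 2 ^ 2 + x 3 ^ 2 + x 4 ^ 2 + x 5 ^ 2 with hr
  have hW : x 4 ^ 2 + x 5 ^ 2 + (x 0 + x 1 + x 2 + x 3) ^ 2 ≤ 4 * r := by
    nlinarith [sq_nonneg (x 0 - x 1), sq_nonneg (x 0 - x 2), sq_nonneg (x 0 - x 3),
      sq_nonneg (x 1 - x 2), sq_nonneg (x 1 - x 3), sq_nonneg (x 2 - x 3),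
      sq_nonneg (x 4), sq_nonneg (x 5)]
  have hW0 : 0 ≤ x 4 ^ 2 + x 5 ^ 2 + (x 0 + x 1 + x 2 + x 3) ^ 2 := by positivity
  have hr0 : 0 ≤ r := by positivity
  rw [ff, abs_of_nonneg (by positivity)]
  have he : 4 * r ≤ 8 * Real.exp (1 / 2 * r) := by
    have := Real.add_one_le_exp (1 / 2 * r)
    linarith
  calc _ ≤ 8 * Real.exp (1 / 2 * r) * Real.exp (-r) := by
        gcongr
        · exact hW.trans he
        · nlinarith [sq_nonneg (x 0 + x 1 + x 2 + x 3),
            sq_nonneg (x 0 + x 1 + x 2 + x 3 - (x 4 + x 5))]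
    _ = _ := by
        rw [mul_assoc, ← Real.exp_add]
        congr 2
        ring

/-- With `Q(p,q) = |p|² + 3σ(p)² + |q|² + σ(q)² − 2σ(p)σ(q)` on `ℤ⁴ × ℤ²`,
`lim_{α→0⁺} α⁴ · ∑_{(p,q)} (|q|² + σ(p)²) · e^{-α Q(p,q)} = 28π³/(31√31)`. -/
theorem stmt14 :
    Tendsto (fun α : ℝ =>
      α ^ 4 * ∑' pq : (Fin 4 → ℤ) × (Fin 2 → ℤ),
        ((∑ i, (pq.2 i : ℝ) ^ 2) + (∑ i, (pq.1 i : ℝ)) ^ 2) *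
          Real.exp (-α * ((∑ i, (pq.1 i : ℝ) ^ 2) + 3 * (∑ i, (pq.1 i : ℝ)) ^ 2
            + (∑ i, (pq.2 i : ℝ) ^ 2) + (∑ i, (pq.2 i : ℝ)) ^ 2
            - 2 * (∑ i, (pq.1 i : ℝ)) * (∑ i, (pq.2 i : ℝ)))))
      (nhdsWithin 0 (Set.Ioi 0))
      (nhds (28 * Real.pi ^ 3 / (31 * Real.sqrt 31))) := by
  have hfc : Continuous ff := by unfold ff; fun_prop
  have key := riemann_sum 6 ff hfc (c := 1 / 2) (C := 8) (by norm_num) (by norm_num) ff_bound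
  rw [ff_integral] at key
  have hsq : Tendsto (fun α : ℝ => √α) (𝓝[>] 0) (𝓝[>] 0) := by
    refine tendsto_nhdsWithin_iff.2 ⟨?_, ?_⟩
    · have : Tendsto (fun α : ℝ => √α) (𝓝 0) (𝓝 √0) := Real.continuous_sqrt.tendsto 0
      rw [Real.sqrt_zero] at this
      exact this.mono_left nhdsWithin_le_nhds
    · filter_upwards [self_mem_nhdsWithin] with a ha
      exact Real.sqrt_pos.2 ha
  refine (key.comp hsq).congr' ?_
  filter_upwards [self_mem_nhdsWithin] with a (ha : 0 < a)
  simp only [Function.comp]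
  rw [← (Fin.appendEquiv (α := ℤ) 4 2).tsum_eq, ← tsum_mul_left, ← tsum_mul_left]
  refine tsum_congr fun pq => ?_
  obtain ⟨p, q⟩ := pq
  have h2 : √a ^ 2 = a := Real.sq_sqrt ha.le
  have w0 : Fin.appendEquiv (α := ℤ) 4 2 (p, q) 0 = p 0 := rfl
  have w1 : Fin.appendEquiv (α := ℤ) 4 2 (p, q) 1 = p 1 := rfl
  have w2 : Fin.appendEquiv (α := ℤ) 4 2 (p, q) 2 = p 2 := rfl
  have w3 : Fin.appendEquiv (α := ℤ) 4 2 (p, q) 3 = p 3 := rfl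
  have w4 : Fin.appendEquiv (α := ℤ) 4 2 (p, q) 4 = q 0 := rfl
  have w5 : Fin.appendEquiv (α := ℤ) 4 2 (p, q) 5 = q 1 := rfl
  simp only [ff, Fin.sum_univ_four, Fin.sum_univ_two]
  rw [w0, w1, w2, w3, w4, w5]
  generalize √a = s at *
  subst h2
  rw [← mul_assoc, ← mul_assoc]
  congr 1
  · ring
  · congr 1; ring
end

section
/- Let m > 0. For p = (p₁,p₂,p₃,p₄) ∈ ℤ⁴ write |p|² = ∑_k p_k², σ(p) = ∑_k p_k, and χ(p) = |p|² + σ(p)² + m². Then lim_{Λ→∞} (1/log Λ) · ∑_{p∈ℤ⁴, ‖p‖₂≤Λ} σ(p)²/χ(p)³ = 2π²/(5√5). -/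
open Filter

namespace S18
open MeasureTheory

lemma int_mat (M : Matrix (Fin 4) (Fin 4) ℝ) (hM : M.det ≠ 0) (g : (Fin 4 → ℝ) → ℝ) :
    ∫ x, g (M.mulVec x) = |M.det⁻¹| * ∫ x, g x := by
  have h := Real.map_matrix_volume_pi_eq_smul_volume_pi hM
  have hemb : MeasurableEmbedding (Matrix.toLin' M) := by
    have hdet : LinearMap.det (Matrix.toLin' M) ≠ 0 := by simpa using hM
    have := (LinearMap.equivOfDetNeZero (Matrix.toLin' M) hdet).toContinuousLinearEquiv.toHomeomorph.measurableEmbedding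
    exact this
  have h2 := hemb.integral_map (μ := volume) g
  rw [h, integral_smul_measure] at h2
  simp only [Matrix.toLin'_apply] at h2
  rw [← h2, ENNReal.toReal_ofReal (abs_nonneg _), smul_eq_mul]

/-- radial cutoff -/
noncomputable def h (t : ℝ) : ℝ := if 1 < t ∧ t ≤ 4 then (t ^ 3)⁻¹ else 0

lemma int_radial : ∫ y : Fin 4 → ℝ, (∑ i, y i ^ 2) * h (∑ i, y i ^ 2) =
    2 * Real.pi ^ 2 * Real.log 2 := by
  have e := (PiLp.volume_preserving_ofLp (Fin 4)).integral_comp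
    ((MeasurableEquiv.toLp 2 (Fin 4 → ℝ)).symm.measurableEmbedding)
    (fun y : Fin 4 → ℝ => (∑ i, y i ^ 2) * h (∑ i, y i ^ 2))
  rw [← e]
  have e2 := integral_fun_norm_addHaar (volume : Measure (EuclideanSpace ℝ (Fin 4)))
    (fun r => r ^ 2 * h (r ^ 2))
  have e3 : ∀ x : EuclideanSpace ℝ (Fin 4), ‖x‖ ^ 2 = ∑ i, x i ^ 2 := by
    intro x; rw [EuclideanSpace.real_norm_sq_eq]
  simp only [e3] at e2
  rw [e2]
  have v : (volume : Measure (EuclideanSpace ℝ (Fin 4))).real (Metric.ball 0 1) = Real.pi ^ 2 / 2 := by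
    rw [measureReal_def, InnerProductSpace.volume_ball_of_dim_even (k := 2) (by simp)]
    have : (0:ℝ) ≤ Real.pi ^ 2 / 2 := by positivity
    simp [this]
  rw [v]
  have e4 : ∫ y in Set.Ioi (0 : ℝ), y ^ (Module.finrank ℝ (EuclideanSpace ℝ (Fin 4)) - 1) •
      (y ^ 2 * h (y ^ 2)) = Real.log 2 := by
    have : ∫ y in Set.Ioi (0 : ℝ), y ^ (Module.finrank ℝ (EuclideanSpace ℝ (Fin 4)) - 1) •
      (y ^ 2 * h (y ^ 2)) = ∫ y in Set.Ioi (0 : ℝ), (Set.Ioc 1 2).indicator (fun y : ℝ => y⁻¹) y := by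
      refine setIntegral_congr_fun measurableSet_Ioi fun y hy => ?_
      have hy : 0 < y := hy
      simp only [finrank_euclideanSpace, Fintype.card_fin, h, Set.indicator, Set.mem_Ioc, smul_eq_mul]
      have : (1 < y ^ 2 ∧ y ^ 2 ≤ 4) ↔ (1 < y ∧ y ≤ 2) := by
        constructor
        · rintro ⟨a, b⟩; constructor <;> nlinarith
        · rintro ⟨a, b⟩; constructor <;> nlinarith
      simp only [this]
      split_ifs
      · field_simp
      · simp
    rw [this, setIntegral_indicator measurableSet_Ioc]
    have : Set.Ioi (0:ℝ) ∩ Set.Ioc 1 2 = Set.Ioc 1 2 := by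
      ext y; simp; intros; linarith
    rw [this, ← intervalIntegral.integral_of_le (by norm_num), integral_inv_of_pos (by norm_num) (by norm_num)]
    norm_num
  rw [e4]
  simp
  ring

lemma integrable_aux (c : Fin 4 → ℝ) :
    Integrable (fun y : Fin 4 → ℝ => (∑ i, c i * y i) ^ 2 * h (∑ i, y i ^ 2)) := by
  have : (fun y : Fin 4 → ℝ => (∑ i, c i * y i) ^ 2 * h (∑ i, y i ^ 2)) =
      Set.indicator {y | 1 < (∑ i, y i ^ 2) ∧ (∑ i, y i ^ 2) ≤ 4}
       (fun y => (∑ i, c i * y i) ^ 2 * ((max (∑ i, y i ^ 2) 1) ^ 3)⁻¹) := by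
    ext y
    simp only [h, Set.indicator, Set.mem_ofPred_eq]
    split_ifs with h1
    · rw [max_eq_left h1.1.le]
    · simp
  rw [this, integrable_indicator_iff]
  · refine (ContinuousOn.integrableOn_compact (isCompact_closedBall (0 : Fin 4 → ℝ) 2) ?_).mono_set ?_
    · apply Continuous.continuousOn
      refine Continuous.mul (by fun_prop) (Continuous.inv₀ (by fun_prop) ?_)
      intro x; positivity
    · rintro y ⟨-, hy⟩
      rw [mem_closedBall_zero_iff, pi_norm_le_iff_of_nonneg (by norm_num)]
      intro i
      have := Finset.single_le_sum (f := fun i => y i ^ 2) (fun i _ => sq_nonneg _) (Finset.mem_univ i)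
      rw [Real.norm_eq_abs]
      apply abs_le_of_sq_le_sq _ (by norm_num)
      have hy : ∑ i, y i ^ 2 ≤ 4 := hy
      norm_num at this ⊢
      linarith
  · have m1 : MeasurableSet {y : Fin 4 → ℝ | 1 < ∑ i, y i ^ 2} :=
      measurableSet_lt (by fun_prop) (by fun_prop)
    have m2 : MeasurableSet {y : Fin 4 → ℝ | ∑ i, y i ^ 2 ≤ 4} :=
      measurableSet_le (by fun_prop) (by fun_prop)
    exact m1.inter m2

lemma int_sign (c : Fin 4 → ℝ) (hc : ∀ i, c i ^ 2 = 1) :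
    ∫ y : Fin 4 → ℝ, (∑ i, c i * y i) ^ 2 * h (∑ i, y i ^ 2) =
    ∫ y : Fin 4 → ℝ, (∑ i, y i) ^ 2 * h (∑ i, y i ^ 2) := by
  have habs : |∏ i, c i| = 1 := by
    have : (∏ i, c i) ^ 2 = 1 := by rw [← Finset.prod_pow]; simp [hc]
    rw [← sq_abs] at this
    exact (pow_eq_one_iff_of_nonneg (abs_nonneg _) (by norm_num)).1 this
  have := int_mat (Matrix.diagonal c) (by
    rw [Matrix.det_diagonal]; intro h0; rw [h0] at habs; simp at habs)
    (fun y => (∑ i, y i) ^ 2 * h (∑ i, y i ^ 2))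
  rw [Matrix.det_diagonal, abs_inv, habs] at this
  simp only [Matrix.mulVec_diagonal, mul_pow, hc, one_mul, inv_one] at this
  exact this

lemma int_sum : ∫ y : Fin 4 → ℝ, (∑ i, y i) ^ 2 * h (∑ i, y i ^ 2) =
    2 * Real.pi ^ 2 * Real.log 2 := by
  rw [← int_radial]
  have h1 := int_sign ![1,1,1,1] (by intro i; fin_cases i <;> simp)
  have h2 := int_sign ![1,1,-1,-1] (by intro i; fin_cases i <;> simp)
  have h3 := int_sign ![1,-1,1,-1] (by intro i; fin_cases i <;> simp)
  have h4 := int_sign ![1,-1,-1,1] (by intro i; fin_cases i <;> simp)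
  have i1 := integrable_aux ![1,1,1,1]
  have i2 := integrable_aux ![1,1,-1,-1]
  have i3 := integrable_aux ![1,-1,1,-1]
  have i4 := integrable_aux ![1,-1,-1,1]
  have key := integral_add (i1.add i2) (i3.add i4)
  have k1 := integral_add i1 i2
  have k2 := integral_add i3 i4
  simp only [Pi.add_apply] at key
  have : (4:ℝ) * ∫ y : Fin 4 → ℝ, (∑ i, y i ^ 2) * h (∑ i, y i ^ 2) =
    4 * ∫ y : Fin 4 → ℝ, (∑ i, y i) ^ 2 * h (∑ i, y i ^ 2) := by
    rw [← integral_const_mul]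
    trans
    swap
    · have : (4:ℝ) * ∫ y : Fin 4 → ℝ, (∑ i, y i) ^ 2 * h (∑ i, y i ^ 2) = _ :=
        (show _ = _ by linarith [key, k1, k2, h1, h2, h3, h4]).trans key.symm
      exact this.symm
    · congr 1
      ext y
      simp [Fin.sum_univ_four]
      ring
  linarith

lemma sqrt5 : Real.sqrt 5 ^ 2 = 5 := Real.sq_sqrt (by norm_num)

/-- The square root of the quadratic form. -/
noncomputable def A : Matrix (Fin 4) (Fin 4) ℝ :=
  1 + Matrix.replicateCol Unit (fun _ : Fin 4 => (Real.sqrt 5 - 1) / 4) *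
    Matrix.replicateRow Unit (fun _ : Fin 4 => (1 : ℝ))

lemma A_det : A.det = Real.sqrt 5 := by
  rw [A, Matrix.det_one_add_replicateCol_mul_replicateRow]
  simp [dotProduct]
  ring

lemma A_apply (x : Fin 4 → ℝ) (i : Fin 4) : A.mulVec x i = x i + (Real.sqrt 5 - 1) / 4 * ∑ j, x j := by
  rw [A, Matrix.add_mulVec, Matrix.one_mulVec, Pi.add_apply]
  congr 1
  simp [Matrix.mulVec, dotProduct, Matrix.mul_apply, Finset.mul_sum]

/-- quadratic form -/
def q (x : Fin 4 → ℝ) : ℝ := ∑ i, x i ^ 2 + (∑ i, x i) ^ 2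

lemma A_sum (x : Fin 4 → ℝ) : ∑ i, A.mulVec x i = Real.sqrt 5 * ∑ i, x i := by
  simp only [A_apply, Fin.sum_univ_four]
  ring

lemma A_sq (x : Fin 4 → ℝ) : ∑ i, A.mulVec x i ^ 2 = q x := by
  simp only [A_apply, Fin.sum_univ_four, q]
  have := sqrt5
  linear_combination ((x 0 + x 1 + x 2 + x 3) ^ 2 / 4) * this

lemma int_q : ∫ x : Fin 4 → ℝ, (∑ i, x i) ^ 2 * h (q x) =
    2 * Real.pi ^ 2 / (5 * Real.sqrt 5) * Real.log 2 := by
  have h5 : 0 < Real.sqrt 5 := by positivity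
  have := int_mat A (by rw [A_det]; exact h5.ne') (fun y => (∑ i, y i) ^ 2 * h (∑ i, y i ^ 2))
  simp only [A_sum, A_sq, mul_pow, sqrt5, mul_assoc] at this
  rw [integral_const_mul, A_det, int_sum, abs_of_pos (by positivity)] at this
  field_simp
  field_simp at this
  linarith

lemma q_null (c : ℝ) : volume {x : Fin 4 → ℝ | q x = c} = 0 := by
  have h5 : 0 < Real.sqrt 5 := by positivity
  have hm := Real.map_matrix_volume_pi_eq_smul_volume_pi (M := A) (by rw [A_det]; exact h5.ne')
  have s1 : volume {y : Fin 4 → ℝ | ∑ i, y i ^ 2 = c} = 0 := by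
    have ms : MeasurableSet {y : Fin 4 → ℝ | ∑ i, y i ^ 2 = c} :=
      measurableSet_eq_fun (by fun_prop) (by fun_prop)
    rw [← (PiLp.volume_preserving_ofLp (Fin 4)).measure_preimage ms.nullMeasurableSet]
    refine measure_mono_null ?_ (Measure.addHaar_sphere volume (0 : EuclideanSpace ℝ (Fin 4)) (Real.sqrt c))
    intro x hx
    simp only [Set.mem_preimage, Set.mem_ofPred_eq] at hx
    rw [mem_sphere_zero_iff_norm, ← hx, ← EuclideanSpace.real_norm_sq_eq, Real.sqrt_sq (norm_nonneg _)]
  have ms : MeasurableSet {y : Fin 4 → ℝ | ∑ i, y i ^ 2 = c} :=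
      measurableSet_eq_fun (by fun_prop) (by fun_prop)
  have : {x : Fin 4 → ℝ | q x = c} = Matrix.toLin' A ⁻¹' {y : Fin 4 → ℝ | ∑ i, y i ^ 2 = c} := by
    ext x; simp [A_sq]
  rw [this, ← Measure.map_apply (LinearMap.continuous_of_finiteDimensional _).measurable ms, hm]
  simp [s1]

/-- cast to real vectors -/
def ct (p : Fin 4 → ℤ) : Fin 4 → ℝ := fun i => (p i : ℝ)

lemma sq_le_q (x : Fin 4 → ℝ) (i : Fin 4) : x i ^ 2 ≤ q x := by
  have := Finset.single_le_sum (f := fun i => x i ^ 2) (fun i _ => sq_nonneg _) (Finset.mem_univ i)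
  have h2 := sq_nonneg (∑ i, x i)
  unfold q
  linarith

lemma q_nonneg (x : Fin 4 → ℝ) : 0 ≤ q x := (sq_nonneg _).trans (sq_le_q x 0)

lemma q_smul (c : ℝ) (x : Fin 4 → ℝ) : q (fun i => c * x i) = c ^ 2 * q x := by
  simp only [q, ← Finset.mul_sum, mul_pow]; ring

lemma q_le (x : Fin 4 → ℝ) : q x ≤ 5 * ∑ i, x i ^ 2 := by
  simp only [q, Fin.sum_univ_four]
  nlinarith [sq_nonneg (x 0 - x 1), sq_nonneg (x 0 - x 2), sq_nonneg (x 0 - x 3),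
    sq_nonneg (x 1 - x 2), sq_nonneg (x 1 - x 3), sq_nonneg (x 2 - x 3)]

@[fun_prop] lemma q_cont : Continuous q := by unfold q; fun_prop

lemma fin_q (R : ℝ) : {p : Fin 4 → ℤ | q (ct p) ≤ R}.Finite := by
  refine (Set.Finite.pi' (t := fun _ : Fin 4 => Set.Icc (-⌈|R| + 1⌉) ⌈|R| + 1⌉)
    (fun _ => Set.finite_Icc _ _)).subset ?_
  intro p hp i
  have h1 : ((p i : ℝ)) ^ 2 ≤ R := (sq_le_q (ct p) i).trans hp
  have h2 : |(p i : ℝ)| ≤ |R| + 1 := by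
    apply abs_le_of_sq_le_sq _ (by positivity) 
    have := le_abs_self R
    nlinarith [abs_nonneg R]
  have h3 := h2.trans (Int.le_ceil _)
  rw [abs_le] at h3
  exact ⟨by exact_mod_cast h3.1, by exact_mod_cast h3.2⟩

/-- shell -/
def s : Set (Fin 4 → ℝ) := {x | 1 < q x ∧ q x ≤ 4}

/-- continuous integrand -/
noncomputable def G (x : Fin 4 → ℝ) : ℝ := (∑ i, x i) ^ 2 * ((max (q x) 1) ^ 3)⁻¹

lemma s_meas : MeasurableSet s :=
  (measurableSet_lt (f := fun _ : Fin 4 → ℝ => (1:ℝ)) (g := q)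
      (by fun_prop) (by fun_prop)).inter
      (measurableSet_le (g := fun _ : Fin 4 → ℝ => (4:ℝ)) (f := q)
      (by fun_prop) (by fun_prop))

lemma s_bdd : Bornology.IsBounded s := by
  refine (Metric.isBounded_closedBall (x := (0 : Fin 4 → ℝ)) (r := 2)).subset ?_
  rintro y ⟨-, hy⟩
  rw [mem_closedBall_zero_iff, pi_norm_le_iff_of_nonneg (by norm_num)]
  intro i
  have := sq_le_q y i
  rw [Real.norm_eq_abs]
  apply abs_le_of_sq_le_sq _ (by norm_num)
  norm_num
  linarith

lemma s_front : volume (frontier s) = 0 := by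
  have h1 : frontier s ⊆ {x | q x = 1} ∪ {x | q x = 4} := by
    have := frontier_inter_subset {x : Fin 4 → ℝ | 1 < q x} {x : Fin 4 → ℝ | q x ≤ 4}
    refine (this.trans (Set.union_subset_union (Set.inter_subset_left.trans ?_)
      (Set.inter_subset_right.trans ?_)))
    · refine (frontier_lt_subset_eq (by fun_prop) (by fun_prop)).trans ?_
      intro x hx; exact Eq.symm hx
    · exact (frontier_le_subset_eq (by fun_prop) (by fun_prop))
  exact measure_mono_null h1 (measure_union_null (q_null 1) (q_null 4))

lemma G_cont : Continuous G := by
  unfold G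
  refine Continuous.mul (by fun_prop) (Continuous.inv₀ (by fun_prop) ?_)
  intro x; positivity

lemma int_G : ∫ x in s, G x = 2 * Real.pi ^ 2 / (5 * Real.sqrt 5) * Real.log 2 := by
  rw [← int_q, ← integral_indicator s_meas]
  congr 1
  ext x
  by_cases h1 : 1 < q x ∧ q x ≤ 4
  · rw [Set.indicator_of_mem (show x ∈ s from h1), G, h, max_eq_left h1.1.le, if_pos h1]
  · rw [Set.indicator_of_notMem (show x ∉ s from h1), h, if_neg h1, mul_zero]

/-- dyadic shells in the lattice -/
noncomputable def U (k : ℕ) : Finset (Fin 4 → ℤ) := (fin_q (4 ^ k)).toFinset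

lemma mem_U (k : ℕ) (p : Fin 4 → ℤ) : p ∈ U k ↔ q (ct p) ≤ 4 ^ k := by
  simp [U]

open scoped Pointwise in
lemma lattice_sum (k : ℕ) :
    (∑' x : ↑(s ∩ (((2 ^ k : ℕ) : ℝ)⁻¹ • (Submodule.span ℤ (Set.range (Pi.basisFun ℝ (Fin 4))) : Set (Fin 4 → ℝ)))), G x)
      / ((2 ^ k : ℕ) : ℝ) ^ Fintype.card (Fin 4) =
    ∑ p ∈ U (k + 1) \ U k, (∑ i, (p i : ℝ)) ^ 2 / q (ct p) ^ 3 := by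
  have : NeZero (2 ^ k : ℕ) := ⟨by positivity⟩
  set n : ℕ := 2 ^ k with hn
  have hn0 : (0:ℝ) < n := by rw [hn]; positivity
  have hn4 : (n:ℝ) ^ 2 = 4 ^ k := by rw [hn]; push_cast; rw [← pow_mul, mul_comm, pow_mul]; norm_num
  have inj : Function.Injective (fun p : Fin 4 → ℤ => (fun i => (n:ℝ)⁻¹ * ct p i)) := by
    intro p p' hpp
    ext i
    have := congrFun hpp i
    simpa [ct, hn0.ne'] using this
  have hq : ∀ p, q (fun i => (n:ℝ)⁻¹ * ct p i) = q (ct p) / 4 ^ k := by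
    intro p; rw [q_smul, inv_pow, hn4]; field_simp
  have mem : ∀ x, x ∈ (s ∩ ((n : ℝ)⁻¹ • (Submodule.span ℤ (Set.range (Pi.basisFun ℝ (Fin 4))) : Set (Fin 4 → ℝ)))) ↔
      x ∈ (U (k + 1) \ U k).image (fun p : Fin 4 → ℤ => (fun i => (n:ℝ)⁻¹ * ct p i)) := by
    intro x
    have key : ∀ p, (fun i => (n:ℝ)⁻¹ * ct p i) ∈ s ↔ p ∈ U (k + 1) \ U k := by
      intro p
      rw [Finset.mem_sdiff, mem_U, mem_U]
      simp only [s, Set.mem_ofPred_eq, hq]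
      rw [lt_div_iff₀ (by positivity), div_le_iff₀ (by positivity), not_le, pow_succ, one_mul, mul_comm (4:ℝ), and_comm]
    rw [Set.mem_inter_iff, Finset.mem_image]
    have hm : x ∈ ((n : ℝ)⁻¹ • (Submodule.span ℤ (Set.range (Pi.basisFun ℝ (Fin 4))) : Set (Fin 4 → ℝ))) ↔ _ :=
      BoxIntegral.unitPartition.mem_smul_span_iff (n := n) (v := x)
    rw [hm]
    constructor
    · rintro ⟨hx, hy⟩
      choose p hp using hy
      have : (fun i => (n:ℝ)⁻¹ * ct p i) = x := by
        ext i
        have := hp i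
        simp only [ct]
        simp at this
        rw [this]; field_simp
      exact ⟨p, (key p).1 (this ▸ hx), this⟩
    · rintro ⟨p, hp, rfl⟩
      refine ⟨(key p).2 hp, fun i => ⟨p i, ?_⟩⟩
      simp [ct]
      field_simp
  rw [tsum_subtype (s ∩ ((n : ℝ)⁻¹ • (Submodule.span ℤ (Set.range (Pi.basisFun ℝ (Fin 4))) : Set (Fin 4 → ℝ)))) G]
  rw [tsum_eq_sum (s := (U (k + 1) \ U k).image (fun p : Fin 4 → ℤ => (fun i => (n:ℝ)⁻¹ * ct p i)))]
  · rw [Finset.sum_image (fun a _ b _ hab => inj hab), Finset.sum_div]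
    refine Finset.sum_congr rfl fun p hp => ?_
    rw [Set.indicator_of_mem ((mem _).2 (Finset.mem_image_of_mem _ hp))]
    have h1 := hp
    rw [Finset.mem_sdiff, mem_U, mem_U, not_le] at h1
    have hpos : 0 < q (ct p) := lt_trans (by positivity) h1.2
    have hq1 : 1 ≤ q (ct p) / n ^ 2 := by rw [hn4, le_div_iff₀ (by positivity)]; linarith
    simp only [G, hq, ← hn4]
    rw [max_eq_left hq1, ← Finset.mul_sum]
    simp only [ct, Fintype.card_fin] at hpos ⊢
    field_simp
  · intro x hx
    exact Set.indicator_of_notMem (fun hx' => hx ((mem x).1 hx')) _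

lemma shell_tendsto : Tendsto (fun k : ℕ => ∑ p ∈ U (k + 1) \ U k, (∑ i, (p i : ℝ)) ^ 2 / q (ct p) ^ 3)
    atTop (nhds (2 * Real.pi ^ 2 / (5 * Real.sqrt 5) * Real.log 2)) := by
  have := tendsto_tsum_div_pow_atTop_integral s G G_cont s_bdd s_meas s_front
  rw [int_G] at this
  have h2 := this.comp (tendsto_pow_atTop_atTop_of_one_lt (one_lt_two : 1 < (2:ℕ)))
  exact h2.congr (fun k => lattice_sum k)

/-- summand -/
noncomputable def F (m : ℝ) (p : Fin 4 → ℤ) : ℝ := (∑ i, (p i : ℝ)) ^ 2 /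
                ((∑ i, (p i : ℝ) ^ 2) + (∑ i, (p i : ℝ)) ^ 2 + m ^ 2) ^ 3

lemma F_eq (m : ℝ) (p : Fin 4 → ℤ) : F m p = (∑ i, (p i : ℝ)) ^ 2 / (q (ct p) + m ^ 2) ^ 3 := rfl

lemma F_nonneg (m : ℝ) (p : Fin 4 → ℤ) : 0 ≤ F m p := by
  rw [F_eq]
  have := q_nonneg (ct p)
  positivity

lemma shell_F (m : ℝ) : Tendsto (fun k : ℕ => ∑ p ∈ U (k + 1) \ U k, F m p)
    atTop (nhds (2 * Real.pi ^ 2 / (5 * Real.sqrt 5) * Real.log 2)) := by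
  have lim : Tendsto (fun k : ℕ => ((1 + m ^ 2 / 4 ^ k) ^ 3)⁻¹) atTop (nhds (1:ℝ)) := by
    have : Tendsto (fun k : ℕ => m ^ 2 / (4:ℝ) ^ k) atTop (nhds 0) :=
      Tendsto.div_atTop tendsto_const_nhds (tendsto_pow_atTop_atTop_of_one_lt (by norm_num))
    have h2 := ((this.const_add 1).pow 3).inv₀ (by norm_num)
    simpa using h2
  have lim2 := lim.mul shell_tendsto
  rw [one_mul] at lim2
  refine tendsto_of_tendsto_of_tendsto_of_le_of_le lim2 shell_tendsto ?_ ?_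
  · intro k
    simp only
    rw [Finset.mul_sum]
    refine Finset.sum_le_sum fun p hp => ?_
    rw [Finset.mem_sdiff, mem_U, mem_U, not_le] at hp
    have h4 : (0:ℝ) < 4 ^ k := by positivity
    have hpos : 0 < q (ct p) := lt_trans h4 hp.2
    rw [F_eq, mul_comm, ← div_eq_mul_inv, div_div]
    have : q (ct p) + m ^ 2 ≤ q (ct p) * (1 + m ^ 2 / 4 ^ k) := by
      have : m ^ 2 = 4 ^ k * (m ^ 2 / 4 ^ k) := by field_simp
      have h0 : 0 ≤ m ^ 2 / 4 ^ k := by positivity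
      nlinarith [hp.2]
    rw [← mul_pow]
    gcongr
  · intro k
    refine Finset.sum_le_sum fun p hp => ?_
    rw [Finset.mem_sdiff, mem_U, mem_U, not_le] at hp
    have hpos : 0 < q (ct p) := lt_trans (by positivity) hp.2
    rw [F_eq]
    gcongr
    nlinarith [sq_nonneg m]

/-- dyadic partial sums -/
noncomputable def T (m : ℝ) (k : ℕ) : ℝ := ∑ p ∈ U k, F m p

lemma T_tendsto (m : ℝ) : Tendsto (fun n : ℕ => T m n / n)
    atTop (nhds (2 * Real.pi ^ 2 / (5 * Real.sqrt 5) * Real.log 2)) := by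
  have h1 := (shell_F m).cesaro
  have h2 : ∀ n, T m n = T m 0 + ∑ k ∈ Finset.range n, ∑ p ∈ U (k + 1) \ U k, F m p := by
    intro n
    induction n with
    | zero => simp
    | succ n ih =>
      rw [Finset.sum_range_succ, ← add_assoc, ← ih]
      suffices hsub : U n ⊆ U (n + 1) from
        (Finset.sum_sdiff hsub).symm.trans (add_comm _ _)
      intro p hp
      rw [mem_U] at *
      exact hp.trans (pow_le_pow_right₀ (by norm_num) (by omega))
  have h3 : Tendsto (fun n : ℕ => T m 0 / (n:ℝ)) atTop (nhds 0) :=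
    Tendsto.div_atTop tendsto_const_nhds tendsto_natCast_atTop_atTop
  have h4 := h3.add h1
  rw [zero_add] at h4
  refine h4.congr fun n => ?_
  rw [h2 n]
  ring

/-- the ball sum -/
noncomputable def S (m : ℝ) (Λ : ℝ) : ℝ := ∑' p : Fin 4 → ℤ,
          Set.indicator {p : Fin 4 → ℤ | Real.sqrt (∑ i, (p i : ℝ) ^ 2) ≤ Λ} (F m) p

lemma S_bounds (m Λ : ℝ) (k : ℕ) (h1 : 2 ^ k ≤ Λ) (h2 : Λ ≤ 2 ^ (k + 1)) :
    T m k ≤ S m Λ ∧ S m Λ ≤ T m (k + 3) := by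
  have h0 : (0:ℝ) ≤ 2 ^ k := by positivity
  have e : ∀ k : ℕ, ((2:ℝ) ^ k) ^ 2 = 4 ^ k := by
    intro k; rw [← pow_mul, mul_comm, pow_mul]; norm_num
  have sub : ∀ p : Fin 4 → ℤ, Real.sqrt (∑ i, (p i : ℝ) ^ 2) ≤ Λ → p ∈ U (k + 3) := by
    intro p hp
    rw [mem_U]
    refine (q_le _).trans ?_
    have h3 := hp.trans h2
    rw [Real.sqrt_le_left (by positivity), e] at h3
    simp only [ct]
    rw [pow_succ, pow_succ]
    have : (0:ℝ) < 4 ^ (k+1) := by positivity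
    linarith
  have sub2 : ∀ p : Fin 4 → ℤ, p ∈ U k → Real.sqrt (∑ i, (p i : ℝ) ^ 2) ≤ Λ := by
    intro p hp
    rw [mem_U] at hp
    refine le_trans ?_ h1
    rw [Real.sqrt_le_left (by positivity), e]
    refine le_trans ?_ hp
    simp only [q, ct]
    linarith [sq_nonneg (∑ i, (p i : ℝ))]
  have hS : S m Λ = ∑ p ∈ U (k + 3),
      Set.indicator {p : Fin 4 → ℤ | Real.sqrt (∑ i, (p i : ℝ) ^ 2) ≤ Λ} (F m) p := by
    refine tsum_eq_sum fun p hp => Set.indicator_of_notMem ?_ _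
    exact fun h => hp (sub p h)
  constructor
  · have : T m k = ∑ p ∈ U k,
      Set.indicator {p : Fin 4 → ℤ | Real.sqrt (∑ i, (p i : ℝ) ^ 2) ≤ Λ} (F m) p :=
      Finset.sum_congr rfl fun p hp => (Set.indicator_of_mem
        (show p ∈ {p : Fin 4 → ℤ | Real.sqrt (∑ i, (p i : ℝ) ^ 2) ≤ Λ} from sub2 p hp) _).symm
    rw [this, hS]
    refine Finset.sum_le_sum_of_subset_of_nonneg (fun p hp => sub p (sub2 p hp)) ?_
    intro p _ _
    exact Set.indicator_nonneg (fun p _ => F_nonneg m p) p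
  · rw [hS]
    exact Finset.sum_le_sum fun p _ => Set.indicator_le_self' (fun p _ => F_nonneg m p) p

lemma main (m : ℝ) : Tendsto (fun Λ : ℝ => (1 / Real.log Λ) * S m Λ)
      atTop (nhds (2 * Real.pi ^ 2 / (5 * Real.sqrt 5))) := by
  set c := 2 * Real.pi ^ 2 / (5 * Real.sqrt 5)
  have hl : 0 < Real.log 2 := Real.log_pos (by norm_num)
  -- floor of the binary logarithm
  let N : ℝ → ℕ := fun Λ => ⌊Real.log Λ / Real.log 2⌋₊
  have hN : Tendsto N atTop atTop :=
    tendsto_nat_floor_atTop.comp (Real.tendsto_log_atTop.atTop_div_const hl)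
  have hT : Tendsto (fun n : ℕ => T m n / n / Real.log 2) atTop (nhds c) := by
    have := (T_tendsto m).div_const (Real.log 2)
    rwa [mul_div_cancel_right₀ _ hl.ne'] at this
  have r1 : Tendsto (fun n : ℕ => (n : ℝ) / (n + 1)) atTop (nhds 1) := tendsto_natCast_div_add_atTop 1
  have r2 : Tendsto (fun n : ℕ => ((n + 3 : ℕ) : ℝ) / n) atTop (nhds 1) := by
    have : Tendsto (fun n : ℕ => 1 + 3 / (n:ℝ)) atTop (nhds (1 + 0)) :=
      (Tendsto.div_atTop tendsto_const_nhds tendsto_natCast_atTop_atTop).const_add 1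
    rw [add_zero] at this
    refine this.congr' ?_
    filter_upwards [eventually_gt_atTop 0] with n hn
    push_cast
    field_simp
  have l1 := ((hT.mul r1).comp hN)
  have l2 := (((hT.comp (tendsto_add_atTop_nat 3)).mul r2).comp hN)
  rw [mul_one] at l1 l2
  have Tn : ∀ n, 0 ≤ T m n := fun n => Finset.sum_nonneg fun p _ => F_nonneg m p
  have facts : ∀ᶠ Λ : ℝ in atTop, 0 < N Λ ∧ 2 ^ N Λ ≤ Λ ∧ Λ ≤ 2 ^ (N Λ + 1) ∧
      N Λ * Real.log 2 ≤ Real.log Λ ∧ Real.log Λ ≤ (N Λ + 1) * Real.log 2 := by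
    filter_upwards [eventually_gt_atTop 1, hN.eventually_gt_atTop 0] with Λ h1 hNp
    have hlog : 0 < Real.log Λ := Real.log_pos h1
    have a : N Λ * Real.log 2 ≤ Real.log Λ := by
      rw [← le_div_iff₀ hl]; exact Nat.floor_le (by positivity)
    have b : Real.log Λ ≤ (N Λ + 1) * Real.log 2 := by
      rw [← div_le_iff₀ hl]; exact (Nat.lt_floor_add_one _).le
    refine ⟨hNp, ?_, ?_, a, b⟩
    · rw [← Real.log_le_log_iff (by positivity) (by linarith), Real.log_pow]; exact a
    · rw [← Real.log_le_log_iff (by linarith) (by positivity), Real.log_pow]; push_cast; exact b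
  refine tendsto_of_tendsto_of_tendsto_of_le_of_le' l1 l2 ?_ ?_
  · filter_upwards [facts] with Λ ⟨hp, h1, h2, h3, h4⟩
    have hp' : (0:ℝ) < N Λ := by exact_mod_cast hp
    have hlog : 0 < Real.log Λ := lt_of_lt_of_le (by positivity) h3
    have hS := (S_bounds m Λ (N Λ) h1 h2).1
    simp only [Function.comp]
    have : T m (N Λ) / N Λ / Real.log 2 * (N Λ / (N Λ + 1)) = T m (N Λ) / ((N Λ + 1) * Real.log 2) := by
      field_simp
    rw [this, one_div, mul_comm _ (S m Λ), ← div_eq_mul_inv]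
    exact div_le_div₀ ((Tn _).trans hS) hS hlog h4
  · filter_upwards [facts] with Λ ⟨hp, h1, h2, h3, h4⟩
    have hp' : (0:ℝ) < N Λ := by exact_mod_cast hp
    have hlog : 0 < Real.log Λ := lt_of_lt_of_le (by positivity) h3
    have hS := (S_bounds m Λ (N Λ) h1 h2).2
    simp only [Function.comp]
    have : T m (N Λ + 3) / ((N Λ + 3 : ℕ) : ℝ) / Real.log 2 * (((N Λ + 3 : ℕ) : ℝ) / N Λ) =
        T m (N Λ + 3) / (N Λ * Real.log 2) := by
      field_simp
    rw [this, one_div, mul_comm _ (S m Λ), ← div_eq_mul_inv]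
    exact div_le_div₀ (Tn _) hS (by positivity) h3

end S18

open Filter

/-- For `m > 0`, with `χ(p) = |p|² + σ(p)² + m²` on `ℤ⁴`,
`lim_{Λ→∞} (1/log Λ) · ∑_{‖p‖₂≤Λ} σ(p)²/χ(p)³ = 2π²/(5√5)`. -/
theorem stmt18 (m : ℝ) (hm : 0 < m) :
    Tendsto (fun Λ : ℝ =>
      (1 / Real.log Λ) *
        ∑' p : Fin 4 → ℤ,
          Set.indicator {p : Fin 4 → ℤ | Real.sqrt (∑ i, (p i : ℝ) ^ 2) ≤ Λ}
            (fun p =>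
              (∑ i, (p i : ℝ)) ^ 2 /
                ((∑ i, (p i : ℝ) ^ 2) + (∑ i, (p i : ℝ)) ^ 2 + m ^ 2) ^ 3) p)
      atTop (nhds (2 * Real.pi ^ 2 / (5 * Real.sqrt 5))) := by
  exact S18.main m
end
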